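/- (Tarski's principle with degree bound) Let A be a semi-algebraic subset of ℝ^{d+1} and let π : ℝ^{d+1} → ℝ^d be the projection π(x₁,…,x_{d+1}) = (x₁,…,x_d). Then π(A) is a semi-algebraic set and deg(π(A)) is bounded by a function of deg(A) and d only. -/

import Mathlib

open Set

noncomputable section

/-- The open unit cube `(0,1)^d`. -/
def cubeO (d : ℕ) : Set (Fin d → ℝ) := {x | ∀ i, x i ∈ Set.Ioo (0:ℝ) 1}

/-- The closed unit cube `[0,1]^d`. -/
def cubeC (d : ℕ) : Set (Fin d → ℝ) := {x | ∀ i, x i ∈ Set.Icc (0:ℝ) 1}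

/-- A presentation of a semi-algebraic set: a finite union (list) of conjunctions, each
given by a list of polynomials required to be `> 0` and a list required to be `= 0`. -/
abbrev SAPres (d : ℕ) :=
  List (List (MvPolynomial (Fin d) ℝ) × List (MvPolynomial (Fin d) ℝ))

/-- The set defined by a presentation. -/
def SAPres.toSet {d : ℕ} (p : SAPres d) : Set (Fin d → ℝ) :=
  {x | ∃ c ∈ p, (∀ P ∈ c.1, 0 < MvPolynomial.eval x P) ∧
                (∀ P ∈ c.2, MvPolynomial.eval x P = 0)}

/-- The degree of a presentation: the sum of the total degrees of the polynomials
involved (with multiplicities). -/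
def SAPres.deg {d : ℕ} (p : SAPres d) : ℕ :=
  (p.map fun c =>
    (c.1.map MvPolynomial.totalDegree).sum + (c.2.map MvPolynomial.totalDegree).sum).sum

/-- A set is semi-algebraic if it admits a presentation. -/
def IsSemialgebraic {d : ℕ} (A : Set (Fin d → ℝ)) : Prop := ∃ p : SAPres d, p.toSet = A

/-- The degree of a semi-algebraic set: the minimum degree of its presentations. -/
def SADeg {d : ℕ} (A : Set (Fin d → ℝ)) : ℕ :=
  sInf (SAPres.deg '' {p : SAPres d | p.toSet = A})

/-- The graph of `f : A → ℝ^n`, `A ⊆ ℝ^k`, as a subset of `ℝ^(k+n)`. -/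
def graphSet {k n : ℕ} (A : Set (Fin k → ℝ)) (f : (Fin k → ℝ) → (Fin n → ℝ)) :
    Set (Fin (k + n) → ℝ) :=
  {z | (fun i => z (Fin.castAdd n i)) ∈ A ∧
       (fun j => z (Fin.natAdd k j)) = f fun i => z (Fin.castAdd n i)}

/-- A map is semi-algebraic if its graph is a semi-algebraic set. -/
def IsSAMap {k n : ℕ} (A : Set (Fin k → ℝ)) (f : (Fin k → ℝ) → (Fin n → ℝ)) : Prop :=
  IsSemialgebraic (graphSet A f)

/-- The degree of a semi-algebraic map is the degree of its graph. -/
def SAMapDeg {k n : ℕ} (A : Set (Fin k → ℝ)) (f : (Fin k → ℝ) → (Fin n → ℝ)) : ℕ :=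
  SADeg (graphSet A f)

/-- Scalar-valued version of `IsSAMap`. -/
def IsSAFun {k : ℕ} (A : Set (Fin k → ℝ)) (f : (Fin k → ℝ) → ℝ) : Prop :=
  IsSAMap A fun x (_ : Fin 1) => f x

/-- Scalar-valued version of `SAMapDeg`. -/
def SAFunDeg {k : ℕ} (A : Set (Fin k → ℝ)) (f : (Fin k → ℝ) → ℝ) : ℕ :=
  SAMapDeg A fun x (_ : Fin 1) => f x

/-- `A ⊆ ℝ^d` is an `m`-dimensional analytic submanifold: around each of its points there is
an analytic chart of `ℝ^d` straightening `A` to a coordinate subspace of dimension `m`. -/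
def IsAnalyticSubmanifold {d : ℕ} (A : Set (Fin d → ℝ)) (m : ℕ) : Prop :=
  ∀ x ∈ A, ∃ (U V : Set (Fin d → ℝ)) (φ ψ : (Fin d → ℝ) → (Fin d → ℝ)),
    IsOpen U ∧ IsOpen V ∧ x ∈ U ∧
    AnalyticOnNhd ℝ φ U ∧ AnalyticOnNhd ℝ ψ V ∧
    (∀ y ∈ U, φ y ∈ V) ∧ (∀ z ∈ V, ψ z ∈ U) ∧
    (∀ y ∈ U, ψ (φ y) = y) ∧ (∀ z ∈ V, φ (ψ z) = z) ∧
    φ '' (U ∩ A) = V ∩ {z | ∀ i : Fin d, m ≤ (i : ℕ) → z i = 0}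

/-- A Nash manifold: an analytic submanifold of `ℝ^d` which is a semi-algebraic set. -/
def IsNashManifold {d : ℕ} (A : Set (Fin d → ℝ)) (m : ℕ) : Prop :=
  IsSemialgebraic A ∧ IsAnalyticSubmanifold A m

/-- A Nash map on `A`: a semi-algebraic map which is analytic on `A` (i.e. extends
analytically around every point of `A`). -/
def IsNashMap {k n : ℕ} (A : Set (Fin k → ℝ)) (f : (Fin k → ℝ) → (Fin n → ℝ)) : Prop :=
  IsSAMap A f ∧ ∀ x ∈ A, ∃ (U : Set (Fin k → ℝ)) (g : (Fin k → ℝ) → (Fin n → ℝ)),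
    IsOpen U ∧ x ∈ U ∧ AnalyticOnNhd ℝ g U ∧ Set.EqOn f g (A ∩ U)

/-- Scalar valued Nash map. -/
def IsNashFun {k : ℕ} (A : Set (Fin k → ℝ)) (f : (Fin k → ℝ) → ℝ) : Prop :=
  IsSAFun A f ∧ ∀ x ∈ A, ∃ (U : Set (Fin k → ℝ)) (g : (Fin k → ℝ) → ℝ),
    IsOpen U ∧ x ∈ U ∧ AnalyticOnNhd ℝ g U ∧ Set.EqOn f g (A ∩ U)

/-- The total degree `|α|` of a multi-index. -/
def mIdxDeg {d : ℕ} (α : Fin d → ℕ) : ℕ := ∑ i, α i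

/-- The total order `≼` on multi-indices: `α ≼ β` iff `|α| < |β|`, or `|α| = |β|` and
`α k ≤ β k` at the largest index `k` where they differ (reflexivity included). -/
def mIdxLE {d : ℕ} (α β : Fin d → ℕ) : Prop :=
  α = β ∨ mIdxDeg α < mIdxDeg β ∨
    (mIdxDeg α = mIdxDeg β ∧ ∃ k, α k < β k ∧ ∀ l, k < l → α l = β l)

/-- Pad a multi-index on `Fin l` to one on `Fin d` by zeros (in the last coordinates). -/
def padIdx {l d : ℕ} (β : Fin l → ℕ) : Fin d → ℕ :=
  fun i => if h : (i : ℕ) < l then β ⟨i, h⟩ else 0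

/-- First-order partial derivative in the `i`-th coordinate direction. -/
def pderiv1 {d : ℕ} (i : Fin d) (f : (Fin d → ℝ) → ℝ) : (Fin d → ℝ) → ℝ :=
  fun x => fderiv ℝ f x (Pi.single i 1)

/-- Iterated partial derivative `∂^β f` associated to a multi-index `β`. -/
def mpderiv {d : ℕ} (β : Fin d → ℕ) (f : (Fin d → ℝ) → ℝ) : (Fin d → ℝ) → ℝ :=
  (List.finRange d).foldl (fun g i => (pderiv1 i)^[β i] g) f

/-- A `C⁰`-Nash map `A → (0,1)^n`: a Nash map with values in the open unit cube which
extends continuously to the closure of `A`. -/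
def IsC0NashMap {k n : ℕ} (A : Set (Fin k → ℝ)) (f : (Fin k → ℝ) → (Fin n → ℝ)) : Prop :=
  IsNashMap A f ∧ (∀ x ∈ A, f x ∈ cubeO n) ∧
    ∃ g : (Fin k → ℝ) → (Fin n → ℝ), ContinuousOn g (closure A) ∧ Set.EqOn f g A

/-- Scalar version of `IsC0NashMap`, with values in `(0,1)`. -/
def IsC0NashFun {k : ℕ} (A : Set (Fin k → ℝ)) (f : (Fin k → ℝ) → ℝ) : Prop :=
  IsNashFun A f ∧ (∀ x ∈ A, f x ∈ Set.Ioo (0:ℝ) 1) ∧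
    ∃ g : (Fin k → ℝ) → ℝ, ContinuousOn g (closure A) ∧ Set.EqOn f g A

/-- The bound `‖f‖_α ≤ K`: all partial derivatives `∂^β f` with `β ≼ α` are bounded by `K`
on `A`.  (Multi-indices `β` on the domain are padded by zeros to be compared with `α`.) -/
def CalphaBound {k e : ℕ} (A : Set (Fin k → ℝ)) (α : Fin e → ℕ) (K : ℝ)
    (f : (Fin k → ℝ) → ℝ) : Prop :=
  ∀ β : Fin k → ℕ, mIdxLE (padIdx β) α → ∀ x ∈ A, |mpderiv β f x| ≤ K

/-- A `(C^α,K)`-Nash map: a `C⁰`-Nash map with `‖f‖_α ≤ K`. -/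
def IsCalphaNashMap {k n e : ℕ} (A : Set (Fin k → ℝ)) (α : Fin e → ℕ) (K : ℝ)
    (f : (Fin k → ℝ) → (Fin n → ℝ)) : Prop :=
  IsC0NashMap A f ∧ ∀ j : Fin n, CalphaBound A α K fun x => f x j

/-- Scalar version of `IsCalphaNashMap`. -/
def IsCalphaNashFun {k e : ℕ} (A : Set (Fin k → ℝ)) (α : Fin e → ℕ) (K : ℝ)
    (f : (Fin k → ℝ) → ℝ) : Prop :=
  IsC0NashFun A f ∧ CalphaBound A α K f

/-- A `(C^r,K)`-Nash map: a `C⁰`-Nash map all of whose partial derivatives of order `≤ r`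
are bounded by `K`. -/
def IsCrNashMap {k n : ℕ} (A : Set (Fin k → ℝ)) (r : ℕ) (K : ℝ)
    (f : (Fin k → ℝ) → (Fin n → ℝ)) : Prop :=
  IsC0NashMap A f ∧ ∀ (j : Fin n) (β : Fin k → ℕ), mIdxDeg β ≤ r →
    ∀ x ∈ A, |mpderiv β (fun y => f y j) x| ≤ K

/-- A triangular map `(0,1)^l → (0,1)^d`: the `(d-l+k)`-th coordinate depends only on the
variables `x_k, …, x_l` (stated here with `0`-based indices). -/
def IsTriangular {l d : ℕ} (ψ : (Fin l → ℝ) → (Fin d → ℝ)) : Prop :=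
  l ≤ d ∧ ∀ (j : Fin d) (x y : Fin l → ℝ),
    (∀ i : Fin l, (j : ℕ) ≤ (i : ℕ) + (d - l) → x i = y i) → ψ x j = ψ y j

/-- `A` has maximum dimension `l`: it admits a finite partition into connected Nash
manifolds of dimensions `≤ l`, with `l` attained. -/
def HasMaxDim {d : ℕ} (A : Set (Fin d → ℝ)) (l : ℕ) : Prop :=
  ∃ (N : ℕ) (S : Fin N → Set (Fin d → ℝ)) (m : Fin N → ℕ),
    (∀ i, IsNashManifold (S i) (m i)) ∧ (∀ i, IsConnected (S i)) ∧
    A = (⋃ i, S i) ∧ (∀ i j, i ≠ j → Disjoint (S i) (S j)) ∧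
    (∀ i, m i ≤ l) ∧ (∃ i, m i = l)

/-- A `(C^α,K)`-resolution, with all cardinality/degree bounds at most `B`, of a finite
family of maps `f j : A → (0,1)`, where `A ⊆ (0,1)^d` has maximum dimension `l`. -/
def HasFamilyResolution {d k : ℕ} (l : ℕ) (A : Set (Fin d → ℝ))
    (f : Fin k → (Fin d → ℝ) → ℝ) (α : Fin d → ℕ) (K B : ℝ) : Prop :=
  ∃ (N : ℕ) (φ : Fin N → (Fin l → ℝ) → (Fin d → ℝ)),
    (∀ i, IsTriangular (φ i)) ∧
    (∀ i, IsCalphaNashMap (cubeO l) α K (φ i)) ∧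
    (∀ i j, IsCalphaNashFun (cubeO l) α K fun x => f j (φ i x)) ∧
    closure A = (⋃ i, φ i '' cubeC l) ∧
    (N : ℝ) ≤ B ∧
    (∀ i, (SAMapDeg (cubeO l) (φ i) : ℝ) ≤ B) ∧
    (∀ i j, (SAFunDeg (cubeO l) (fun x => f j (φ i x)) : ℝ) ≤ B)

/-- The open slice `{(x₁,y) ∈ (0,1) × S : f y < x₁ < g y}` in `ℝ^(d+1)`. -/
def bandSlice {d : ℕ} (S : Set (Fin d → ℝ)) (f g : (Fin d → ℝ) → ℝ) :
    Set (Fin (d+1) → ℝ) :=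
  {z | z 0 ∈ Set.Ioo (0:ℝ) 1 ∧ Fin.tail z ∈ S ∧ f (Fin.tail z) < z 0 ∧ z 0 < g (Fin.tail z)}

/-- The graph slice `{(f y, y) : y ∈ S}` in `ℝ^(d+1)`. -/
def graphSlice {d : ℕ} (S : Set (Fin d → ℝ)) (f : (Fin d → ℝ) → ℝ) :
    Set (Fin (d+1) → ℝ) :=
  {z | Fin.tail z ∈ S ∧ z 0 = f (Fin.tail z)}

/-- The Euclidean distance from a point to a set. -/
def eDist {d : ℕ} (x : Fin d → ℝ) (S : Set (Fin d → ℝ)) : ℝ :=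
  sInf ((fun y => Real.sqrt (∑ i, (x i - y i) ^ 2)) '' S)

end

section

open Polynomial Filter

/-- An increasing bijection of the line supported in `(a, b)` that moves `u` up to `v`. -/
theorem exists_orderIso_bump_of_le {a b u v : ℝ} (hau : a < u) (huv : u ≤ v) (hvb : v < b) :
    ∃ g : ℝ ≃o ℝ, g u = v ∧ ∀ y ∉ Ioo a b, g y = y := by
  have h1 : 0 < u - a := by linarith
  have h2 : 0 < b - u := by linarith
  have hs : 1 ≤ (v - a) / (u - a) := by rw [le_div_iff₀ h1]; linarith
  have ht : (b - v) / (b - u) ≤ 1 := by rw [div_le_iff₀ h2]; linarith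
  have ht0 : 0 < (b - v) / (b - u) := div_pos (by linarith) h2
  set s := (v - a) / (u - a) with hs_def
  set t := (b - v) / (b - u) with ht_def
  let F : ℝ → ℝ := fun y => max y (min (a + (y - a) * s) (b - (b - y) * t))
  have hmono : StrictMono F := by
    intro x y hxy
    refine max_lt_max hxy (min_lt_min ?_ ?_) <;> nlinarith
  have hcont : Continuous F := by fun_prop
  have hout : ∀ y ∉ Ioo a b, F y = y := by
    intro y hy
    refine max_eq_left ?_
    rcases le_or_gt y a with h | h
    · exact (min_le_left _ _).trans (by nlinarith)
    · have : b ≤ y := by by_contra! hb; exact hy ⟨h, hb⟩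
      exact (min_le_right _ _).trans (by nlinarith)
  have htop : Tendsto F atTop atTop :=
    tendsto_atTop_mono (fun y => le_max_left _ _) tendsto_id
  have hbot : Tendsto F atBot atBot := by
    refine tendsto_id.congr' ?_
    filter_upwards [eventually_le_atBot a] with y hy
    exact (hout y fun h => absurd h.1 (not_lt.2 hy)).symm
  refine ⟨hmono.orderIsoOfSurjective F (hcont.surjective htop hbot), ?_, hout⟩
  change max u (min (a + (u - a) * s) (b - (b - u) * t)) = v
  have e1 : a + (u - a) * s = v := by rw [hs_def]; field_simp; ring
  have e2 : b - (b - u) * t = v := by rw [ht_def]; field_simp; ring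
  rw [e1, e2, min_self, max_eq_right huv]

theorem exists_orderIso_bump {a b u v : ℝ} (hu : u ∈ Ioo a b) (hv : v ∈ Ioo a b) :
    ∃ g : ℝ ≃o ℝ, g u = v ∧ ∀ y ∉ Ioo a b, g y = y := by
  rcases le_total u v with h | h
  · exact exists_orderIso_bump_of_le hu.1 h hv.2
  · obtain ⟨g, h1, h2⟩ := exists_orderIso_bump_of_le hv.1 h hu.2
    refine ⟨g.symm, by rw [← h1, g.symm_apply_apply], fun y hy => ?_⟩
    rw [OrderIso.symm_apply_eq, h2 y hy]

/-- A property holding on a finite set and near `-∞` holds at a point left of `w`, with no point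
of the finite set in between. -/
theorem exists_lt_of_eventually_atBot {Z : Finset ℝ} {G : ℝ → Prop} (hZ : ∀ z ∈ Z, G z)
    (hG : ∀ᶠ y in atBot, G y) (w : ℝ) : ∃ z < w, G z ∧ ∀ x ∈ Ioo z w, x ∉ Z := by
  rcases (Z.filter (· < w)).eq_empty_or_nonempty with h | h
  · obtain ⟨z, hz, hzw⟩ := (hG.and (eventually_lt_atBot w)).exists
    refine ⟨z, hzw, hz, fun x hx hxZ => ?_⟩
    have : x ∈ Z.filter (· < w) := by simp [hxZ, hx.2]
    simp [h] at this
  · obtain ⟨z, hz, hmax⟩ := (Z.filter (· < w)).exists_max_image id h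
    simp only [Finset.mem_filter] at hz
    refine ⟨z, hz.2, hZ z hz.1, fun x hx hxZ => ?_⟩
    exact absurd (hmax x (by simp [hxZ, hx.2])) (not_le.2 hx.1)

theorem exists_gt_of_eventually_atTop {Z : Finset ℝ} {G : ℝ → Prop} (hZ : ∀ z ∈ Z, G z)
    (hG : ∀ᶠ y in atTop, G y) (w : ℝ) : ∃ z > w, G z ∧ ∀ x ∈ Ioo w z, x ∉ Z := by
  rcases (Z.filter (w < ·)).eq_empty_or_nonempty with h | h
  · obtain ⟨z, hz, hzw⟩ := (hG.and (eventually_gt_atTop w)).exists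
    refine ⟨z, hzw, hz, fun x hx hxZ => ?_⟩
    have : x ∈ Z.filter (w < ·) := by simp [hxZ, hx.1]
    simp [h] at this
  · obtain ⟨z, hz, hmin⟩ := (Z.filter (w < ·)).exists_min_image id h
    simp only [Finset.mem_filter] at hz
    refine ⟨z, hz.2, hZ z hz.1, fun x hx hxZ => ?_⟩
    exact absurd (hmin x (by simp [hxZ, hx.1])) (not_le.2 hx.2)

theorem sign_eq_of_mul_pos {a b : ℝ} (h : 0 < a * b) : SignType.sign a = SignType.sign b := by
  rcases pos_and_pos_or_neg_and_neg_of_mul_pos h with h | h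
  · rw [sign_pos h.1, sign_pos h.2]
  · rw [sign_neg h.1, sign_neg h.2]

theorem mul_neg_of_sign_eq {a b c d : ℝ} (h₁ : SignType.sign a = SignType.sign c)
    (h₂ : SignType.sign b = SignType.sign d) (h : a * b < 0) : c * d < 0 := by
  rw [← sign_eq_neg_one_iff, sign_mul] at h ⊢
  rwa [← h₁, ← h₂]

theorem exists_eval_eq_zero_of_mul_neg (p : ℝ[X]) {x y : ℝ} (hxy : x < y)
    (h : p.eval x * p.eval y < 0) : ∃ z ∈ Ioo x y, p.eval z = 0 := by
  rcases mul_neg_iff.1 h with h | h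
  · exact intermediate_value_Ioo' hxy.le p.continuous.continuousOn ⟨h.2, h.1⟩
  · exact intermediate_value_Ioo hxy.le p.continuous.continuousOn ⟨h.1, h.2⟩

/-- A polynomial without zeros on an interval has constant sign there. -/
theorem sign_eval_eq_of_forall_ne_zero (p : ℝ[X]) {s : Set ℝ} (hs : s.OrdConnected)
    (h : ∀ x ∈ s, p.eval x ≠ 0) {x y : ℝ} (hx : x ∈ s) (hy : y ∈ s) :
    SignType.sign (p.eval x) = SignType.sign (p.eval y) := by
  wlog hxy : x < y generalizing x y
  · rcases eq_or_lt_of_le (not_lt.1 hxy) with e | e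
    · rw [e]
    · exact (this hy hx e).symm
  refine sign_eq_of_mul_pos ?_
  by_contra! hc
  obtain ⟨z, hz, hz0⟩ := exists_eval_eq_zero_of_mul_neg p hxy
    (lt_of_le_of_ne hc (mul_ne_zero (h x hx) (h y hy)))
  exact h z (hs.out hx hy (Ioo_subset_Icc_self hz)) hz0

theorem exists_eval_sub_eq_derivative_mul (p : ℝ[X]) {x y : ℝ} (hxy : x < y) :
    ∃ z ∈ Ioo x y, p.eval y - p.eval x = p.derivative.eval z * (y - x) := by
  obtain ⟨z, hz, h⟩ := exists_deriv_eq_slope (fun t => p.eval t) hxy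
    p.continuous.continuousOn p.differentiable.differentiableOn
  refine ⟨z, hz, ?_⟩
  rw [Polynomial.deriv] at h
  rw [h, div_mul_cancel₀ _ (by linarith)]

/-- The sign of a polynomial just right of `z` is read off from its sign and that of its
derivative. -/
theorem sign_eval_right (p : ℝ[X]) {z y : ℝ} (hzy : z < y) (h : ∀ x ∈ Ioc z y, p.eval x ≠ 0)
    (h' : ∀ x ∈ Ioc z y, p.derivative.eval x ≠ 0) :
    SignType.sign (p.eval y) = if SignType.sign (p.eval z) = 0
      then SignType.sign (p.derivative.eval y) else SignType.sign (p.eval z) := by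
  split_ifs with hz
  · rw [sign_eq_zero_iff] at hz
    obtain ⟨ξ, hξ, e⟩ := exists_eval_sub_eq_derivative_mul p hzy
    rw [hz, sub_zero] at e
    rw [e, sign_mul, sign_pos (sub_pos.2 hzy), mul_one]
    exact sign_eval_eq_of_forall_ne_zero _ ordConnected_Ioc h' (Ioo_subset_Ioc_self hξ)
      (right_mem_Ioc.2 hzy)
  · rw [sign_eq_zero_iff] at hz
    refine sign_eval_eq_of_forall_ne_zero p (s := Icc z y) ordConnected_Icc ?_
      (right_mem_Icc.2 hzy.le) (left_mem_Icc.2 hzy.le)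
    intro x hx
    rcases eq_or_lt_of_le hx.1 with e | e
    · rwa [← e]
    · exact h x ⟨e, hx.2⟩

theorem eq_of_eval_eq_zero_of_derivative_ne_zero (p : ℝ[X]) {a b x y : ℝ}
    (h' : ∀ t ∈ Ioo a b, p.derivative.eval t ≠ 0) (hx : x ∈ Ioo a b) (hy : y ∈ Ioo a b)
    (hpx : p.eval x = 0) (hpy : p.eval y = 0) : x = y := by
  wlog hxy : x < y generalizing x y
  · rcases eq_or_lt_of_le (not_lt.1 hxy) with e | e
    · exact e.symm
    · exact (this hy hx hpy hpx e).symm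
  obtain ⟨ξ, hξ, e⟩ := exists_eval_sub_eq_derivative_mul p hxy
  rw [hpx, hpy, sub_zero, eq_comm, mul_eq_zero] at e
  rcases e with e | e
  · exact absurd e (h' ξ ⟨hx.1.trans hξ.1, hξ.2.trans hy.2⟩)
  · linarith

/-- A root of `f` between consecutive critical points forces a root of any polynomial with the
same signs at the end points. -/
theorem exists_eval_eq_zero_of_sign_eq (f g : ℝ[X]) {a w b c d : ℝ} (hw : w ∈ Ioo a b)
    (hfw : f.eval w = 0) (h' : ∀ t ∈ Ioo a b, f.derivative.eval t ≠ 0) (hcd : c < d)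
    (ha : SignType.sign (f.eval a) = SignType.sign (g.eval c))
    (hb : SignType.sign (f.eval b) = SignType.sign (g.eval d)) :
    ∃ x ∈ Ioo c d, g.eval x = 0 := by
  refine exists_eval_eq_zero_of_mul_neg g hcd (mul_neg_of_sign_eq ha hb ?_)
  obtain ⟨ξ, hξ, e⟩ := exists_eval_sub_eq_derivative_mul f hw.1
  obtain ⟨η, hη, e'⟩ := exists_eval_sub_eq_derivative_mul f hw.2
  have hξ' : ξ ∈ Ioo a b := ⟨hξ.1, hξ.2.trans hw.2⟩
  have hη' : η ∈ Ioo a b := ⟨hw.1.trans hη.1, hη.2⟩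
  have hs := sign_eval_eq_of_forall_ne_zero _ ordConnected_Ioo h' hξ' hη'
  rw [hfw, zero_sub] at e
  rw [hfw, sub_zero] at e'
  have hpos : 0 < f.derivative.eval ξ * f.derivative.eval η := by
    rw [← sign_eq_one_iff, sign_mul, hs, ← sign_mul, sign_eq_one_iff]
    exact mul_self_pos.2 (h' η hη')
  have h1 : 0 < (w - a) * (b - w) := mul_pos (sub_pos.2 hw.1) (sub_pos.2 hw.2)
  have : f.eval a * f.eval b =
      -((f.derivative.eval ξ * f.derivative.eval η) * ((w - a) * (b - w))) := by
    rw [e', ← neg_neg (f.eval a), e]; ring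
  rw [this]
  exact neg_lt_zero.2 (mul_pos hpos h1)

section Extend

variable {ι : Type*} {q q' : ι → ℝ[X]} {f g : ℝ[X]} {Z : Finset ℝ}

/-- Moving one root of `f` onto a root of `g` without disturbing the signs already matched. -/
theorem exists_orderIso_move_root {h : ℝ ≃o ℝ}
    (hq : ∀ i y, SignType.sign ((q i).eval y) = SignType.sign ((q' i).eval (h y)))
    (hZ : ∀ i, q i ≠ 0 → ∀ y, (q i).eval y = 0 → y ∈ Z)
    (hf : ∀ y, f.derivative.eval y = 0 → y ∈ Z)
    (hfZ : ∀ z ∈ Z, SignType.sign (f.eval z) = SignType.sign (g.eval (h z)))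
    (htop : ∀ᶠ y in atTop, SignType.sign (f.eval y) = SignType.sign (g.eval (h y)))
    (hbot : ∀ᶠ y in atBot, SignType.sign (f.eval y) = SignType.sign (g.eval (h y)))
    {w : ℝ} (hwZ : w ∉ Z) (hfw : f.eval w = 0) :
    ∃ k : ℝ ≃o ℝ,
      (∀ i y, SignType.sign ((q i).eval y) = SignType.sign ((q' i).eval (k y))) ∧
      (∀ z ∈ Z, k z = h z) ∧ (∀ x, f.eval x = 0 → x ≠ w → k x = h x) ∧
      (∀ᶠ y in atTop, k y = h y) ∧ (∀ᶠ y in atBot, k y = h y) ∧ g.eval (k w) = 0 := by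
  obtain ⟨a, haw, ha, haZ⟩ := exists_lt_of_eventually_atBot hfZ hbot w
  obtain ⟨b, hwb, hb, hbZ⟩ := exists_gt_of_eventually_atTop hfZ htop w
  have hab : ∀ x ∈ Ioo a b, x ∉ Z := by
    intro x hx
    rcases lt_trichotomy x w with e | e | e
    · exact haZ x ⟨hx.1, e⟩
    · exact e ▸ hwZ
    · exact hbZ x ⟨e, hx.2⟩
  have hw : w ∈ Ioo a b := ⟨haw, hwb⟩
  have hf' : ∀ x ∈ Ioo a b, f.derivative.eval x ≠ 0 := fun x hx e => hab x hx (hf x e)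
  obtain ⟨v, hv, hgv⟩ := exists_eval_eq_zero_of_sign_eq f g hw hfw hf'
    (h.lt_iff_lt.2 (haw.trans hwb)) ha hb
  have hmem : ∀ {y}, h y ∈ Ioo (h a) (h b) ↔ y ∈ Ioo a b := by simp
  obtain ⟨m, hm, hm'⟩ := exists_orderIso_bump (hmem.2 hw) hv
  have hout : ∀ y, y ∉ Ioo a b → (h.trans m) y = h y := fun y hy => hm' _ (hmem.not.2 hy)
  refine ⟨h.trans m, fun i y => ?_, fun z hz => hout z fun hz' => hab z hz' hz,
    fun x hx hxw => hout x fun hx' => hxw ?_, ?_, ?_, ?_⟩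
  · by_cases hy : y ∈ Ioo a b
    · have hy' : m (h y) ∈ Ioo (h a) (h b) := by
        have h1 := hm' (h a) (by simp)
        have h2 := hm' (h b) (by simp)
        rw [mem_Ioo, ← h1, ← h2]
        simpa using hy
      rw [hq i y]
      by_cases hi : q i = 0
      · have h0 : ∀ x, (q' i).eval x = 0 := fun x => by
          have := hq i (h.symm x)
          rw [hi, eval_zero, sign_zero, eq_comm, sign_eq_zero_iff, h.apply_symm_apply] at this
          exact this
        rw [h0, h0]
      · refine sign_eval_eq_of_forall_ne_zero (q' i) ordConnected_Ioo (fun x hx hx0 => ?_)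
          (hmem.2 hy) hy'
        have := hq i (h.symm x)
        rw [h.apply_symm_apply, hx0, sign_zero, sign_eq_zero_iff] at this
        rw [← h.apply_symm_apply x, hmem] at hx
        exact hab _ hx (hZ i hi _ this)
    · rw [hout y hy, hq i y]
  · exact eq_of_eval_eq_zero_of_derivative_ne_zero f hf' hx' hw hx hfw
  · filter_upwards [eventually_ge_atTop b] with y hy
    exact hout y fun h => absurd h.2 (not_lt.2 hy)
  · filter_upwards [eventually_le_atBot a] with y hy
    exact hout y fun h => absurd h.1 (not_lt.2 hy)
  · change g.eval (m (h w)) = 0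
    rw [hm, hgv]

theorem exists_orderIso_move_roots {h : ℝ ≃o ℝ}
    (hq : ∀ i y, SignType.sign ((q i).eval y) = SignType.sign ((q' i).eval (h y)))
    (hZ : ∀ i, q i ≠ 0 → ∀ y, (q i).eval y = 0 → y ∈ Z)
    (hf : ∀ y, f.derivative.eval y = 0 → y ∈ Z)
    (hfZ : ∀ z ∈ Z, SignType.sign (f.eval z) = SignType.sign (g.eval (h z)))
    (htop : ∀ᶠ y in atTop, SignType.sign (f.eval y) = SignType.sign (g.eval (h y)))
    (hbot : ∀ᶠ y in atBot, SignType.sign (f.eval y) = SignType.sign (g.eval (h y)))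
    (W : Finset ℝ) (hW : ∀ w ∈ W, f.eval w = 0) :
    ∃ k : ℝ ≃o ℝ,
      (∀ i y, SignType.sign ((q i).eval y) = SignType.sign ((q' i).eval (k y))) ∧
      (∀ z ∈ Z, k z = h z) ∧ (∀ᶠ y in atTop, k y = h y) ∧ (∀ᶠ y in atBot, k y = h y) ∧
      ∀ w ∈ W, g.eval (k w) = 0 := by
  induction W using Finset.induction_on with
  | empty => exact ⟨h, hq, by simp, by simp, by simp, by simp⟩
  | insert w W hwW ih =>
    obtain ⟨k, k1, k2, k3, k4, k5⟩ := ih fun x hx => hW x (Finset.mem_insert_of_mem hx)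
    have hw := hW w (Finset.mem_insert_self w W)
    have hkZ : ∀ z ∈ Z, SignType.sign (f.eval z) = SignType.sign (g.eval (k z)) :=
      fun z hz => by rw [k2 z hz, hfZ z hz]
    by_cases hwZ : w ∈ Z
    · refine ⟨k, k1, k2, k3, k4, fun x hx => ?_⟩
      rcases Finset.mem_insert.1 hx with rfl | hx
      · have := hkZ x hwZ
        rwa [hw, sign_zero, eq_comm, sign_eq_zero_iff] at this
      · exact k5 x hx
    · obtain ⟨m, m1, m2, m3, m4, m5, m6⟩ := exists_orderIso_move_root k1 hZ hf hkZ
        (by filter_upwards [htop, k3] with y h1 h2; rw [h1, h2])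
        (by filter_upwards [hbot, k4] with y h1 h2; rw [h1, h2]) hwZ hw
      refine ⟨m, m1, fun z hz => (m2 z hz).trans (k2 z hz), ?_, ?_, fun x hx => ?_⟩
      · filter_upwards [m4, k3] with y h1 h2; rw [h1, h2]
      · filter_upwards [m5, k4] with y h1 h2; rw [h1, h2]
      · rcases Finset.mem_insert.1 hx with rfl | hx'
        · exact m6
        · rw [m3 x (hW x hx) (by rintro rfl; exact hwW hx'), k5 x hx']

/-- The inductive step of sign determination: if the signs of a family containing `f'` match
those of a family containing `g'` along `h`, and the signs of `f` and `g` match at the zeros of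
the family and at infinity, then `h` can be modified so that the signs of `f` and `g` match too. -/
theorem exists_orderIso_extend {h : ℝ ≃o ℝ}
    (hq : ∀ i y, SignType.sign ((q i).eval y) = SignType.sign ((q' i).eval (h y)))
    (hZ : ∀ i, q i ≠ 0 → ∀ y, (q i).eval y = 0 → y ∈ Z)
    {i₀ : ι} (hf : q i₀ = f.derivative) (hg : q' i₀ = g.derivative) (hf0 : f.derivative ≠ 0)
    (hfZ : ∀ z ∈ Z, SignType.sign (f.eval z) = SignType.sign (g.eval (h z)))
    (htop : ∀ᶠ y in atTop, SignType.sign (f.eval y) = SignType.sign (g.eval (h y)))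
    (hbot : ∀ᶠ y in atBot, SignType.sign (f.eval y) = SignType.sign (g.eval (h y))) :
    ∃ k : ℝ ≃o ℝ,
      (∀ i y, SignType.sign ((q i).eval y) = SignType.sign ((q' i).eval (k y))) ∧
      ∀ y, SignType.sign (f.eval y) = SignType.sign (g.eval (k y)) := by
  have hf'Z : ∀ y, f.derivative.eval y = 0 → y ∈ Z := by
    rw [← hf] at hf0 ⊢
    exact hZ i₀ hf0
  have hfne : f ≠ 0 := by rintro rfl; simp at hf0
  obtain ⟨k, k1, k2, k3, k4, k5⟩ := exists_orderIso_move_roots hq hZ hf'Z hfZ htop hbot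
    f.roots.toFinset (fun w hw => by simpa [hfne] using hw)
  replace k5 : ∀ w, f.eval w = 0 → g.eval (k w) = 0 := fun w hw => k5 w (by simpa [hfne] using hw)
  have hkZ : ∀ z ∈ Z, SignType.sign (f.eval z) = SignType.sign (g.eval (k z)) :=
    fun z hz => by rw [k2 z hz, hfZ z hz]
  have hktop : ∀ᶠ y in atTop, SignType.sign (f.eval y) = SignType.sign (g.eval (k y)) := by
    filter_upwards [htop, k3] with y h1 h2; rw [h1, h2]
  have hkbot : ∀ᶠ y in atBot, SignType.sign (f.eval y) = SignType.sign (g.eval (k y)) := by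
    filter_upwards [hbot, k4] with y h1 h2; rw [h1, h2]
  have hder : ∀ y, SignType.sign (f.derivative.eval y) = SignType.sign (g.derivative.eval (k y)) :=
    fun y => by rw [← hf, ← hg, k1]
  have hgder : ∀ {a b}, (∀ x ∈ Ioo a b, x ∉ Z) →
      ∀ x ∈ Ioo (k a) (k b), g.derivative.eval x ≠ 0 := by
    intro a b hab x hx hx0
    have := hder (k.symm x)
    rw [k.apply_symm_apply, hx0, sign_zero, sign_eq_zero_iff] at this
    refine hab (k.symm x) ?_ (hf'Z _ this)
    rw [← k.apply_symm_apply x] at hx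
    exact ⟨k.lt_iff_lt.1 hx.1, k.lt_iff_lt.1 hx.2⟩
  -- every root of `g` comes from a root of `f`
  have hroot : ∀ v, g.eval (k v) = 0 → f.eval v = 0 := by
    intro v hv
    by_cases hvZ : v ∈ Z
    · have := hkZ v hvZ
      rwa [hv, sign_zero, sign_eq_zero_iff] at this
    obtain ⟨a, hav, ha, haZ⟩ := exists_lt_of_eventually_atBot hkZ hkbot v
    obtain ⟨b, hvb, hb, hbZ⟩ := exists_gt_of_eventually_atTop hkZ hktop v
    have hab : ∀ x ∈ Ioo a b, x ∉ Z := by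
      intro x hx
      rcases lt_trichotomy x v with e | e | e
      · exact haZ x ⟨hx.1, e⟩
      · exact e ▸ hvZ
      · exact hbZ x ⟨e, hx.2⟩
    have hkv : k v ∈ Ioo (k a) (k b) := by simp [hav, hvb]
    obtain ⟨w, hw, hw0⟩ := exists_eval_eq_zero_of_sign_eq g f hkv hv (hgder hab)
      (hav.trans hvb) ha.symm hb.symm
    have : k w = k v := eq_of_eval_eq_zero_of_derivative_ne_zero g (hgder hab)
      (by simpa using hw) hkv (k5 w hw0) hv
    rwa [← k.injective this]
  refine ⟨k, k1, fun y => ?_⟩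
  by_cases hy : f.eval y = 0
  · rw [hy, k5 y hy]
  by_cases hyZ : y ∈ Z
  · exact hkZ y hyZ
  have hZ' : ∀ z ∈ Z ∪ f.roots.toFinset,
      SignType.sign (f.eval z) = SignType.sign (g.eval (k z)) := by
    intro z hz
    rcases Finset.mem_union.1 hz with hz | hz
    · exact hkZ z hz
    · have hz' : f.eval z = 0 := by simpa [hfne] using hz
      rw [hz', k5 z hz']
  obtain ⟨z, hzy, hz, hzZ⟩ := exists_lt_of_eventually_atBot hZ' hkbot y
  have hfI : ∀ x ∈ Ioc z y, f.eval x ≠ 0 := by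
    intro x hx hx0
    rcases eq_or_lt_of_le hx.2 with e | e
    · exact hy (e ▸ hx0)
    · exact hzZ x ⟨hx.1, e⟩ (Finset.mem_union_right _ (by simpa [hfne] using hx0))
  have hf'I : ∀ x ∈ Ioc z y, f.derivative.eval x ≠ 0 := by
    intro x hx hx0
    rcases eq_or_lt_of_le hx.2 with e | e
    · exact hyZ (hf'Z y (e ▸ hx0))
    · exact hzZ x ⟨hx.1, e⟩ (Finset.mem_union_left _ (hf'Z x hx0))
  have hmem : ∀ {x}, x ∈ Ioc (k z) (k y) → k.symm x ∈ Ioc z y := by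
    intro x hx
    rwa [mem_Ioc, ← k.lt_iff_lt, ← k.le_iff_le, k.apply_symm_apply]
  rw [sign_eval_right f hzy hfI hf'I, sign_eval_right g (k.lt_iff_lt.2 hzy), hz, hder]
  · intro x hx hx0
    exact hfI _ (hmem hx) (hroot _ (by rwa [k.apply_symm_apply]))
  · intro x hx hx0
    refine hf'I _ (hmem hx) ?_
    have := hder (k.symm x)
    rwa [k.apply_symm_apply, hx0, sign_zero, sign_eq_zero_iff] at this

end Extend
end

section

open Polynomial Filter

theorem eventually_sign_eval_eq_atTop {p : ℝ[X]} (hp : p ≠ 0) :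
    ∀ᶠ y in atTop, SignType.sign (p.eval y) = SignType.sign p.leadingCoeff := by
  wlog h : 0 < p.leadingCoeff generalizing p
  · have hlt : p.leadingCoeff < 0 := lt_of_le_of_ne (not_lt.1 h) (leadingCoeff_ne_zero.2 hp)
    filter_upwards [this (p := -p) (neg_ne_zero.2 hp) (by simpa using hlt)] with y hy
    simpa [Left.sign_neg] using hy
  rw [sign_pos h]
  rcases Nat.eq_zero_or_pos p.natDegree with h0 | h0
  · rw [eq_C_of_natDegree_eq_zero h0] at h ⊢
    simp only [leadingCoeff_C] at h
    simp [sign_pos h]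
  · have := p.tendsto_atTop_of_leadingCoeff_nonneg (natDegree_pos_iff_degree_pos.1 h0) h.le
    filter_upwards [this.eventually_gt_atTop 0] with y hy
    exact sign_pos hy

theorem eventually_sign_eval_eq_atBot {p : ℝ[X]} (hp : p ≠ 0) :
    ∀ᶠ y in atBot, SignType.sign (p.eval y) =
      SignType.sign (p.leadingCoeff * (-1) ^ p.natDegree) := by
  have hne : p.comp (-X) ≠ 0 := by
    rw [Ne, comp_neg_X_eq_zero_iff]; exact hp
  have := tendsto_neg_atBot_atTop.eventually (eventually_sign_eval_eq_atTop hne)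
  filter_upwards [this] with y hy
  rw [comp_neg_X_leadingCoeff_eq, eval_comp, eval_neg, eval_X, neg_neg] at hy
  rw [hy, mul_comm]

variable {R : Type*} [CommRing R]

/-- Pseudo-division of polynomials over a commutative ring. -/
theorem exists_pseudo_remainder (Q : R[X]) (hQ : Q.natDegree ≠ 0) (P : R[X]) :
    ∃ (r A : R[X]) (k : ℕ), C (Q.leadingCoeff ^ k) * P = A * Q + r ∧
      r.natDegree < Q.natDegree := by
  induction hn : P.natDegree using Nat.strong_induction_on generalizing P with
  | _ n ih =>
    by_cases hlt : n < Q.natDegree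
    · exact ⟨P, 0, 0, by simp, hn ▸ hlt⟩
    push Not at hlt
    set P' := C Q.leadingCoeff * P - C P.leadingCoeff * X ^ (n - Q.natDegree) * Q with hP'
    have hdeg : P'.natDegree ≤ n := by
      refine (natDegree_sub_le _ _).trans (max_le ?_ ?_)
      · exact (natDegree_C_mul_le _ _).trans hn.le
      · refine (natDegree_mul_le).trans ?_
        have := natDegree_C_mul_X_pow_le P.leadingCoeff (n - Q.natDegree)
        omega
    have hcoeff : P'.coeff n = 0 := by
      obtain ⟨l, rfl⟩ := Nat.exists_eq_add_of_le' hlt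
      rw [hP', Nat.add_sub_cancel, coeff_sub, coeff_C_mul, mul_assoc, coeff_C_mul,
        coeff_X_pow_mul', if_pos (Nat.le_add_right _ _), Nat.add_sub_cancel_left, coeff_natDegree,
        ← hn, coeff_natDegree, mul_comm, sub_self]
    have hlt' : P'.natDegree < n := by
      have := natDegree_le_pred hdeg hcoeff
      omega
    obtain ⟨r, A, k, e, hr⟩ := ih _ hlt' P' rfl
    refine ⟨r, A + C (Q.leadingCoeff ^ k) * (C P.leadingCoeff * X ^ (n - Q.natDegree)), k + 1,
      ?_, hr⟩
    rw [pow_succ, C_mul]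
    linear_combination e - C (Q.leadingCoeff ^ k) * hP'

/-- The remainder of a chosen pseudo-division (junk if `Q` is constant). -/
noncomputable def pseudoRem (P Q : R[X]) : R[X] :=
  open Classical in
  if hQ : Q.natDegree ≠ 0 then (exists_pseudo_remainder Q hQ P).choose else 0

theorem pseudoRem_spec (P : R[X]) {Q : R[X]} (hQ : Q.natDegree ≠ 0) :
    ∃ (A : R[X]) (k : ℕ), C (Q.leadingCoeff ^ k) * P = A * Q + pseudoRem P Q ∧
      (pseudoRem P Q).natDegree < Q.natDegree := by
  rw [pseudoRem, dif_pos hQ]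
  exact (exists_pseudo_remainder Q hQ P).choose_spec

theorem natDegree_eraseLead_lt {P : R[X]} (hP : P.natDegree ≠ 0) :
    P.eraseLead.natDegree < P.natDegree := by
  have := P.eraseLead_natDegree_le
  omega

/-- Closure under derivatives, truncations and pseudo-remainders. -/
structure IsSignClosed (G : Finset R[X]) : Prop where
  derivative : ∀ Q ∈ G, Q.natDegree ≠ 0 → Q.derivative ∈ G
  eraseLead : ∀ Q ∈ G, Q.natDegree ≠ 0 → Q.eraseLead ∈ G
  pseudoRem : ∀ P ∈ G, ∀ Q ∈ G, Q.natDegree ≠ 0 → Q.natDegree ≤ P.natDegree → pseudoRem P Q ∈ G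

open Classical in
/-- One round of adding derivatives, truncations and pseudo-remainders. -/
noncomputable def signStep (G : Finset R[X]) : Finset R[X] :=
  G ∪ (((G ×ˢ G).filter fun x => x.2.natDegree ≠ 0 ∧ x.2.natDegree ≤ x.1.natDegree).biUnion
    fun x => {x.2.derivative, x.2.eraseLead, pseudoRem x.1 x.2})

theorem mem_signStep {G : Finset R[X]} {P : R[X]} :
    P ∈ signStep G ↔ P ∈ G ∨ ∃ A ∈ G, ∃ B ∈ G, B.natDegree ≠ 0 ∧ B.natDegree ≤ A.natDegree ∧
      (P = B.derivative ∨ P = B.eraseLead ∨ P = pseudoRem A B) := by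
  simp only [signStep, Finset.mem_union, Finset.mem_biUnion, Finset.mem_filter, Finset.mem_product,
    Finset.mem_insert, Finset.mem_singleton, Prod.exists]
  constructor
  · rintro (h | ⟨A, B, ⟨⟨hA, hB⟩, h1, h2⟩, h3⟩)
    exacts [.inl h, .inr ⟨A, hA, B, hB, h1, h2, h3⟩]
  · rintro (h | ⟨A, hA, B, hB, h1, h2, h3⟩)
    exacts [.inl h, .inr ⟨A, B, ⟨⟨hA, hB⟩, h1, h2⟩, h3⟩]

theorem exists_isSignClosed (S : Finset R[X]) : ∃ G : Finset R[X], S ⊆ G ∧ IsSignClosed G := by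
  obtain ⟨n, hn⟩ : ∃ n, ∀ P ∈ S, P.natDegree ≤ n := ⟨S.sup natDegree, fun P => Finset.le_sup⟩
  have hsub : ∀ j, signStep^[j] S ⊆ signStep^[j + 1] S := fun j P hP => by
    rw [Function.iterate_succ_apply', mem_signStep]; exact .inl hP
  have hlt : ∀ {A B P : R[X]}, B.natDegree ≠ 0 →
      (P = B.derivative ∨ P = B.eraseLead ∨ P = pseudoRem A B) →
      P.natDegree < B.natDegree := by
    rintro A B P h1 (rfl | rfl | rfl)
    exacts [natDegree_derivative_lt h1, natDegree_eraseLead_lt h1,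
      (pseudoRem_spec A h1).choose_spec.choose_spec.2]
  have hnew : ∀ j, ∀ P ∈ signStep^[j + 1] S, P ∉ signStep^[j] S → P.natDegree + j < n := by
    intro j
    induction j with
    | zero =>
      intro P hP hP'
      rw [Function.iterate_succ_apply', mem_signStep] at hP
      rcases hP with hP | ⟨A, hA, B, hB, h1, h2, h3⟩
      · exact absurd hP hP'
      · have hlt := hlt h1 h3
        have := hn B hB
        omega
    | succ j ih =>
      intro P hP hP'
      rw [Function.iterate_succ_apply', mem_signStep] at hP
      rcases hP with hP | ⟨A, hA, B, hB, h1, h2, h3⟩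
      · exact absurd hP hP'
      · have hlt := hlt h1 h3
        by_cases hB' : B ∈ signStep^[j] S
        · by_cases hA' : A ∈ signStep^[j] S
          · refine absurd ?_ hP'
            rw [Function.iterate_succ_apply', mem_signStep]
            exact .inr ⟨A, hA', B, hB', h1, h2, h3⟩
          · have := ih A hA hA'
            omega
        · have := ih B hB hB'
          omega
  have hfix : ∀ P ∈ signStep^[n + 1] S, P ∈ signStep^[n] S := by
    intro P hP
    by_contra hP'
    have := hnew n P hP hP'
    omega
  have hstep : ∀ A ∈ signStep^[n] S, ∀ B ∈ signStep^[n] S, B.natDegree ≠ 0 →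
      B.natDegree ≤ A.natDegree → ∀ P,
      (P = B.derivative ∨ P = B.eraseLead ∨ P = pseudoRem A B) → P ∈ signStep^[n] S := by
    intro A hA B hB h1 h2 P hP
    refine hfix P ?_
    rw [Function.iterate_succ_apply', mem_signStep]
    exact .inr ⟨A, hA, B, hB, h1, h2, hP⟩
  refine ⟨signStep^[n] S, ?_, ?_, ?_, ?_⟩
  · have : ∀ j, S ⊆ signStep^[j] S := by
      intro j
      induction j with
      | zero => exact subset_rfl
      | succ j ih => exact ih.trans (hsub j)
    exact this n
  · exact fun Q hQ h => hstep Q hQ Q hQ h le_rfl _ (.inl rfl)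
  · exact fun Q hQ h => hstep Q hQ Q hQ h le_rfl _ (.inr (.inl rfl))
  · exact fun P hP Q hQ h h' => hstep P hP Q hQ h h' _ (.inr (.inr rfl))

theorem map_eraseLead_of_map_leadingCoeff_eq_zero {φ : R →+* ℝ} {P : R[X]}
    (h : φ P.leadingCoeff = 0) : P.eraseLead.map φ = P.map φ := by
  nth_rw 2 [← P.eraseLead_add_C_mul_X_pow]
  rw [Polynomial.map_add, Polynomial.map_mul, map_C, h, C_0, zero_mul, add_zero]

/-- If two specializations `φ`, `φ'` give the leading coefficients of a closed family the same
signs, then the families of specialized polynomials have the same sign patterns on the line. -/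
theorem exists_orderIso_sign_map_eq {G : Finset R[X]} (hG : IsSignClosed G) {φ φ' : R →+* ℝ}
    (hφ : ∀ P ∈ G, SignType.sign (φ P.leadingCoeff) = SignType.sign (φ' P.leadingCoeff))
    (S : Finset R[X]) (hSG : S ⊆ G)
    (hS : ∀ P ∈ S, ∀ Q ∈ G, Q.natDegree < P.natDegree → Q ∈ S) :
    ∃ h : ℝ ≃o ℝ, ∀ P ∈ S, ∀ y,
      SignType.sign ((P.map φ).eval y) = SignType.sign ((P.map φ').eval (h y)) := by
  classical
  induction hc : S.card generalizing S with
  | zero =>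
    rw [Finset.card_eq_zero] at hc
    exact ⟨OrderIso.refl ℝ, by simp [hc]⟩
  | succ n ih =>
    obtain ⟨P, hP, hmax⟩ := S.exists_max_image natDegree
      (Finset.card_pos.1 (by omega))
    obtain ⟨h, hh⟩ := ih (S.erase P) ((S.erase_subset P).trans hSG) (by
      intro A hA Q hQ hlt
      have hA' := Finset.mem_of_mem_erase hA
      refine Finset.mem_erase.2 ⟨?_, hS A hA' Q hQ hlt⟩
      rintro rfl
      exact absurd (hmax A hA') (not_le.2 hlt)) (by rw [Finset.card_erase_of_mem hP]; omega)
    have hlow : ∀ Q ∈ G, Q.natDegree < P.natDegree → Q ∈ S.erase P := fun Q hQ hlt =>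
      Finset.mem_erase.2 ⟨by rintro rfl; exact lt_irrefl _ hlt, hS P hP Q hQ hlt⟩
    suffices ∃ k : ℝ ≃o ℝ, (∀ Q ∈ S.erase P, ∀ y,
        SignType.sign ((Q.map φ).eval y) = SignType.sign ((Q.map φ').eval (k y))) ∧
        ∀ y, SignType.sign ((P.map φ).eval y) = SignType.sign ((P.map φ').eval (k y)) by
      obtain ⟨k, k1, k2⟩ := this
      refine ⟨k, fun Q hQ => ?_⟩
      by_cases e : Q = P
      · exact e ▸ k2
      · exact k1 Q (Finset.mem_erase.2 ⟨e, hQ⟩)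
    have hPG := hSG hP
    have hlc := hφ P hPG
    by_cases hdeg : P.natDegree = 0
    · refine ⟨h, hh, fun y => ?_⟩
      rw [leadingCoeff, hdeg] at hlc
      rw [eq_C_of_natDegree_eq_zero hdeg]
      simpa using hlc
    by_cases hlc0 : φ P.leadingCoeff = 0
    · have hlc0' : φ' P.leadingCoeff = 0 := by
        rwa [hlc0, sign_zero, eq_comm, sign_eq_zero_iff] at hlc
      refine ⟨h, hh, fun y => ?_⟩
      have := hh _ (hlow _ (hG.eraseLead P hPG hdeg) (natDegree_eraseLead_lt hdeg)) y
      rwa [map_eraseLead_of_map_leadingCoeff_eq_zero hlc0,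
        map_eraseLead_of_map_leadingCoeff_eq_zero hlc0'] at this
    have hlc0' : φ' P.leadingCoeff ≠ 0 := by
      rwa [Ne, ← sign_eq_zero_iff, ← hlc, sign_eq_zero_iff]
    have hnd := natDegree_map_of_leadingCoeff_ne_zero φ hlc0
    have hnd' := natDegree_map_of_leadingCoeff_ne_zero φ' hlc0'
    have hl := leadingCoeff_map_of_leadingCoeff_ne_zero φ hlc0
    have hl' := leadingCoeff_map_of_leadingCoeff_ne_zero φ' hlc0'
    have hPne : P.map φ ≠ 0 := by rintro e; simp [e] at hnd; omega
    have hPne' : P.map φ' ≠ 0 := by rintro e; simp [e] at hnd'; omega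
    -- signs at the roots of the other members of the family, by pseudo-division
    have hzero : ∀ m, ∀ Q ∈ S.erase P, Q.natDegree = m → Q.map φ ≠ 0 → ∀ z,
        (Q.map φ).eval z = 0 →
        SignType.sign ((P.map φ).eval z) = SignType.sign ((P.map φ').eval (h z)) := by
      intro m
      induction m using Nat.strong_induction_on with
      | _ m ihm =>
        intro Q hQ hQm hQ0 z hz
        have hQS := Finset.mem_of_mem_erase hQ
        have hQG := hSG hQS
        by_cases hQd : Q.natDegree = 0
        · rw [eq_C_of_natDegree_eq_zero hQd] at hQ0 hz
          simp only [map_C, eval_C] at hz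
          simp [hz] at hQ0
        by_cases hQl : φ Q.leadingCoeff = 0
        · have e := map_eraseLead_of_map_leadingCoeff_eq_zero hQl
          have hlt := natDegree_eraseLead_lt hQd
          refine ihm _ (hQm ▸ hlt) Q.eraseLead ?_ rfl (e ▸ hQ0) z (e ▸ hz)
          exact hlow _ (hG.eraseLead Q hQG hQd) (hlt.trans_le (hmax Q hQS))
        obtain ⟨A, k, e, hlt⟩ := pseudoRem_spec P hQd
        have hr := hh _ (hlow _ (hG.pseudoRem P hPG Q hQG hQd (hmax Q hQS))
          (hlt.trans_le (hmax Q hQS))) z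
        have hz' : (Q.map φ').eval (h z) = 0 := by
          have := hh Q hQ z
          rwa [hz, sign_zero, eq_comm, sign_eq_zero_iff] at this
        have e1 := congrArg (fun p => (p.map φ).eval z) e
        have e2 := congrArg (fun p => (p.map φ').eval (h z)) e
        simp only [Polynomial.map_mul, Polynomial.map_add, map_C, eval_mul, eval_add, eval_C, hz,
          hz', mul_zero, zero_add, RingHom.map_pow φ, RingHom.map_pow φ'] at e1 e2
        rw [← e1, ← e2, sign_mul, sign_mul, sign_pow, sign_pow, ← hφ Q hQG] at hr
        refine mul_left_cancel₀ (pow_ne_zero k ?_) hr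
        rwa [Ne, sign_eq_zero_iff]
    have htop : ∀ᶠ y in atTop,
        SignType.sign ((P.map φ).eval y) = SignType.sign ((P.map φ').eval (h y)) := by
      filter_upwards [eventually_sign_eval_eq_atTop hPne,
        h.tendsto_atTop.eventually (eventually_sign_eval_eq_atTop hPne')] with y h1 h2
      rw [h1, h2, hl, hl', hlc]
    have hbot : ∀ᶠ y in atBot,
        SignType.sign ((P.map φ).eval y) = SignType.sign ((P.map φ').eval (h y)) := by
      filter_upwards [eventually_sign_eval_eq_atBot hPne,
        h.tendsto_atBot.eventually (eventually_sign_eval_eq_atBot hPne')] with y h1 h2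
      rw [h1, h2, hl, hl', hnd, hnd', sign_mul, sign_mul, hlc]
    let Z : Finset ℝ := (S.erase P).biUnion fun Q => (Q.map φ).roots.toFinset
    obtain ⟨k, k1, k2⟩ := exists_orderIso_extend (ι := S.erase P) (q := fun Q => Q.1.map φ)
      (q' := fun Q => Q.1.map φ') (f := P.map φ) (g := P.map φ') (Z := Z) (h := h)
      (fun Q => hh Q.1 Q.2)
      (fun Q hQ y hy => Finset.mem_biUnion.2 ⟨Q.1, Q.2, by simpa [hQ] using hy⟩)
      (i₀ := ⟨P.derivative, hlow _ (hG.derivative P hPG hdeg) (natDegree_derivative_lt hdeg)⟩)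
      (derivative_map P φ).symm (derivative_map P φ').symm
      (fun e => hdeg (hnd ▸ derivative_eq_zero.1 e))
      (fun z hz => by
        obtain ⟨Q, hQ, hz⟩ := Finset.mem_biUnion.1 hz
        rw [Multiset.mem_toFinset, mem_roots'] at hz
        exact hzero _ Q hQ rfl hz.1 z hz.2)
      htop hbot
    exact ⟨k, fun Q hQ => k1 ⟨Q, hQ⟩, k2⟩

/-- **Sign determination.** The sign pattern on the line of finitely many polynomials with
parameters is determined by the signs of finitely many elements of the parameter ring. -/
theorem exists_finset_sign_determines (S : Finset R[X]) :
    ∃ F : Finset R, ∀ φ φ' : R →+* ℝ, (∀ f ∈ F, SignType.sign (φ f) = SignType.sign (φ' f)) →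
      ∃ h : ℝ ≃o ℝ, ∀ P ∈ S, ∀ y,
        SignType.sign ((P.map φ).eval y) = SignType.sign ((P.map φ').eval (h y)) := by
  classical
  obtain ⟨G, hSG, hG⟩ := exists_isSignClosed S
  refine ⟨G.image leadingCoeff, fun φ φ' hφ => ?_⟩
  obtain ⟨h, hh⟩ := exists_orderIso_sign_map_eq hG
    (fun P hP => hφ _ (Finset.mem_image_of_mem _ hP)) G subset_rfl fun _ _ Q hQ _ => hQ
  exact ⟨h, fun P hP => hh P (hSG hP)⟩

end

open MvPolynomial

section Presentation

variable {d : ℕ}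

theorem totalDegree_bind₁_le {σ τ : Type*} (g : σ → MvPolynomial τ ℝ) {D : ℕ}
    (hg : ∀ i, (g i).totalDegree ≤ D) (f : MvPolynomial σ ℝ) :
    (bind₁ g f).totalDegree ≤ f.totalDegree * D := by
  rw [bind₁, aeval_def, eval₂_eq]
  refine totalDegree_finsetSum_le fun m hm => ?_
  refine (totalDegree_mul _ _).trans ?_
  rw [algebraMap_eq, totalDegree_C, zero_add]
  refine (totalDegree_finsetProd _ _).trans ?_
  refine (Finset.sum_le_sum fun i _ => (totalDegree_pow (g i) (m i)).trans
    (Nat.mul_le_mul_left _ (hg i))).trans ?_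
  rw [← Finset.sum_mul]
  exact Nat.mul_le_mul_right _ (le_totalDegree hm)

/-- The coefficient of `y ^ i` of a polynomial in `(x, y)`, where `y` is the last variable. -/
noncomputable def lastCoeff (P : MvPolynomial (Fin (d + 1)) ℝ) (i : ℕ) : MvPolynomial (Fin d) ℝ :=
  (finSuccEquiv ℝ d (rename (Fin.snoc (α := fun _ => Fin (d + 1)) Fin.succ 0) P)).coeff i

theorem totalDegree_lastCoeff_le (P : MvPolynomial (Fin (d + 1)) ℝ) (i : ℕ) :
    (lastCoeff P i).totalDegree ≤ P.totalDegree := by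
  by_cases h : lastCoeff P i = 0
  · simp [h]
  · have := totalDegree_coeff_finSuccEquiv_add_le _ i h
    exact ((Nat.le_add_right _ _).trans this).trans (totalDegree_rename_le _ _)

theorem sum_eval_lastCoeff (P : MvPolynomial (Fin (d + 1)) ℝ) {D : ℕ} (hD : P.totalDegree ≤ D)
    (x : Fin d → ℝ) (y : ℝ) :
    ∑ i ∈ Finset.range (D + 1), eval x (lastCoeff P i) * y ^ i =
      eval (Fin.snoc (α := fun _ => ℝ) x y) P := by
  set e : Fin (d + 1) → Fin (d + 1) := Fin.snoc (α := fun _ => Fin (d + 1)) Fin.succ 0 with he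
  have hcons : (Fin.cons y x : Fin (d + 1) → ℝ) ∘ e = Fin.snoc (α := fun _ => ℝ) x y := by
    funext j
    refine Fin.lastCases ?_ (fun j => ?_) j <;> simp [he]
  rw [← hcons, ← eval_rename, eval_eq_eval_mv_eval', Polynomial.eval_eq_sum_range' (n := D + 1)]
  · simp [lastCoeff, he]
  · refine Nat.lt_succ_of_le (Polynomial.natDegree_map_le.trans ?_)
    rw [natDegree_finSuccEquiv]
    exact (degreeOf_le_totalDegree _ _).trans ((totalDegree_rename_le _ _).trans hD)

theorem SAPres.toSet_append (p q : SAPres d) :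
    SAPres.toSet (p ++ q) = p.toSet ∪ q.toSet := by
  ext x
  simp only [SAPres.toSet, List.mem_append, mem_ofPred_eq, mem_union, or_and_right, exists_or]

theorem SAPres.deg_append (p q : SAPres d) :
    SAPres.deg (p ++ q) = p.deg + q.deg := by
  simp [SAPres.deg]

theorem exists_presentation_biUnion {ι : Type*} (T : Finset ι) (S : ι → Set (Fin d → ℝ)) (B : ℕ)
    (h : ∀ i ∈ T, ∃ p : SAPres d, p.toSet = S i ∧ p.deg ≤ B) :
    ∃ p : SAPres d, p.toSet = (⋃ i ∈ T, S i) ∧ p.deg ≤ T.card * B := by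
  classical
  induction T using Finset.induction_on with
  | empty => exact ⟨[], by simp [SAPres.toSet], by simp [SAPres.deg]⟩
  | insert i T hi ih =>
    obtain ⟨p, hp, hpB⟩ := ih fun j hj => h j (Finset.mem_insert_of_mem hj)
    obtain ⟨q, hq, hqB⟩ := h i (Finset.mem_insert_self i T)
    refine ⟨q ++ p, ?_, ?_⟩
    · rw [SAPres.toSet_append, hp, hq, Finset.set_biUnion_insert]
    · rw [SAPres.deg_append, Finset.card_insert_of_notMem hi, Nat.add_one_mul]
      omega

/-- A realization of a given sign vector of the family `F` has an explicit presentation. -/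
theorem exists_presentation_sign_eq (F : Finset (MvPolynomial (Fin d) ℝ)) {N E : ℕ}
    (hN : F.card ≤ N) (hE : ∀ f ∈ F, f.totalDegree ≤ E) (s : MvPolynomial (Fin d) ℝ → SignType) :
    ∃ p : SAPres d, p.toSet = {x | ∀ f ∈ F, SignType.sign (eval x f) = s f} ∧
      p.deg ≤ N * E := by
  classical
  let a := ((F.filter (s · ≠ 0)).toList).map fun f => if s f = 1 then f else -f
  let b := (F.filter (s · = 0)).toList
  refine ⟨[(a, b)], ?_, ?_⟩
  · ext x
    simp only [SAPres.toSet, List.mem_singleton, exists_eq_left, mem_ofPred_eq, a, b, List.forall_mem_map,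
      Finset.mem_toList, Finset.mem_filter, and_imp]
    constructor
    · rintro ⟨h1, h2⟩ f hf
      by_cases h0 : s f = 0
      · rw [h0, h2 f hf h0, sign_zero]
      · have := h1 f hf h0
        split_ifs at this with h
        · rw [h, sign_pos this]
        · rw [map_neg, Left.neg_pos_iff] at this
          rw [sign_neg this]
          cases hs : s f <;> simp_all
    · intro h
      refine ⟨fun f hf h0 => ?_, fun f hf h0 => ?_⟩
      · split_ifs with h1
        · rw [← sign_eq_one_iff, h f hf, h1]
        · have : s f = -1 := by cases hs : s f <;> simp_all
          rw [map_neg, Left.neg_pos_iff, ← sign_eq_neg_one_iff, h f hf, this]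
      · rw [← sign_eq_zero_iff, h f hf, h0]
  · have ha : (a.map totalDegree).sum ≤ (F.filter (s · ≠ 0)).card * E := by
      refine (List.sum_le_card_nsmul _ E ?_).trans (by simp [a])
      simp only [a, List.mem_map, Finset.mem_toList, Finset.mem_filter]
      rintro _ ⟨_, ⟨f, ⟨hf, _⟩, rfl⟩, rfl⟩
      split_ifs
      · exact hE f hf
      · rw [totalDegree_neg]; exact hE f hf
    have hb : (b.map totalDegree).sum ≤ (F.filter (s · = 0)).card * E := by
      refine (List.sum_le_card_nsmul _ E ?_).trans (by simp [b])
      simp only [b, List.mem_map, Finset.mem_toList, Finset.mem_filter]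
      rintro _ ⟨f, ⟨hf, _⟩, rfl⟩
      exact hE f hf
    have hc := F.card_filter_add_card_filter_not (s · = 0)
    have : SAPres.deg [(a, b)] = (a.map totalDegree).sum + (b.map totalDegree).sum := by
      simp [SAPres.deg]
    rw [this]
    calc _ ≤ (F.filter (s · ≠ 0)).card * E + (F.filter (s · = 0)).card * E := add_le_add ha hb
      _ = F.card * E := by rw [← hc]; ring
      _ ≤ N * E := Nat.mul_le_mul_right _ hN

/-- A set that depends only on the signs of a finite family of polynomials is semi-algebraic. -/
theorem exists_presentation_of_sign_determined (F : Finset (MvPolynomial (Fin d) ℝ)) {N E : ℕ}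
    (hN : F.card ≤ N) (hE : ∀ f ∈ F, f.totalDegree ≤ E) (S : Set (Fin d → ℝ))
    (hS : ∀ x x', (∀ f ∈ F, SignType.sign (eval x f) = SignType.sign (eval x' f)) →
      x ∈ S → x' ∈ S) :
    ∃ p : SAPres d, p.toSet = S ∧ p.deg ≤ 3 ^ N * (N * E) := by
  classical
  let sg : (Fin d → ℝ) → F → SignType := fun x f => SignType.sign (eval x f.1)
  let T : Finset (F → SignType) := Finset.univ.filter fun s => ∃ x ∈ S, sg x = s
  obtain ⟨p, hp, hpB⟩ := exists_presentation_biUnion T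
    (fun s => {x | ∀ f ∈ F, SignType.sign (eval x f) = if h : f ∈ F then s ⟨f, h⟩ else 0})
    (N * E) (fun s _ => exists_presentation_sign_eq F hN hE _)
  refine ⟨p, hp.trans ?_, hpB.trans (Nat.mul_le_mul_right _ ?_)⟩
  · ext x
    simp only [mem_iUnion, mem_ofPred_eq, T, Finset.mem_filter, Finset.mem_univ, true_and,
      exists_prop]
    constructor
    · rintro ⟨_, ⟨x', hx', rfl⟩, h⟩
      refine hS x' x (fun f hf => ?_) hx'
      rw [h f hf, dif_pos hf]
    · intro hx
      refine ⟨sg x, ⟨x, hx, rfl⟩, fun f hf => ?_⟩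
      rw [dif_pos hf]
  · calc T.card ≤ Fintype.card (F → SignType) := Finset.card_le_univ _
      _ = 3 ^ F.card := by simp [show Fintype.card SignType = 3 from rfl]
      _ ≤ 3 ^ N := Nat.pow_le_pow_right (by norm_num) hN

end Presentation

section Projection

/-- The general polynomials of degree at most `D` in one variable, indexed by `Bool × ℕ`. -/
noncomputable def generalPoly (D : ℕ) (b : Bool) (j : ℕ) : Polynomial (MvPolynomial (Bool × ℕ × ℕ) ℝ) :=
  ∑ i ∈ Finset.range (D + 1), Polynomial.C (X (b, j, i)) * Polynomial.X ^ i

/-- The set cut out by one system of strict inequalities and equations. -/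
def conjSet {d : ℕ} (c : List (MvPolynomial (Fin d) ℝ) × List (MvPolynomial (Fin d) ℝ)) :
    Set (Fin d → ℝ) :=
  {x | (∀ P ∈ c.1, 0 < eval x P) ∧ ∀ P ∈ c.2, eval x P = 0}

/-- Projections of systems of at most `D + D` polynomials of degree at most `D` have
presentations of degree bounded in terms of `D` only. -/
theorem exists_bound_projection_conjSet (D : ℕ) :
    ∃ B : ℕ, ∀ (d : ℕ)
      (c : List (MvPolynomial (Fin (d + 1)) ℝ) × List (MvPolynomial (Fin (d + 1)) ℝ)),
      c.1.length ≤ D → c.2.length ≤ D → (∀ P ∈ c.1, P.totalDegree ≤ D) →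
      (∀ P ∈ c.2, P.totalDegree ≤ D) →
      ∃ p : SAPres d, p.toSet = (fun x (i : Fin d) => x i.castSucc) '' conjSet c ∧ p.deg ≤ B := by
  classical
  obtain ⟨F, hF⟩ := exists_finset_sign_determines
    ((Finset.univ ×ˢ Finset.range D).image fun x : Bool × ℕ => generalPoly D x.1 x.2)
  refine ⟨3 ^ F.card * (F.card * (F.sup totalDegree * D)), fun d c hl1 hl2 hd1 hd2 => ?_⟩
  let L : Bool → List (MvPolynomial (Fin (d + 1)) ℝ) := fun b => cond b c.1 c.2
  have hLD : ∀ b j, ((L b).getD j 0).totalDegree ≤ D := by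
    intro b j
    by_cases hj : j < (L b).length
    · rw [List.getD_eq_getElem _ _ hj]
      have := List.getElem_mem hj
      cases b
      exacts [hd2 _ this, hd1 _ this]
    · rw [List.getD_eq_default _ _ (not_lt.1 hj)]
      simp
  have hLl : ∀ b, (L b).length ≤ D := by rintro (_ | _) <;> assumption
  let g : Bool × ℕ × ℕ → MvPolynomial (Fin d) ℝ :=
    fun t => lastCoeff ((L t.1).getD t.2.1 0) t.2.2
  let φ : (Fin d → ℝ) → MvPolynomial (Bool × ℕ × ℕ) ℝ →+* ℝ :=
    fun x => (eval x).comp (bind₁ g).toRingHom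
  have hφ : ∀ x y b j, ((generalPoly D b j).map (φ x)).eval y =
      eval (Fin.snoc (α := fun _ => ℝ) x y) ((L b).getD j 0) := by
    intro x y b j
    rw [← sum_eval_lastCoeff _ (hLD b j)]
    simp [generalPoly, Polynomial.eval_finsetSum, Polynomial.map_sum, φ, g]
  refine exists_presentation_of_sign_determined (F.image (bind₁ g)) Finset.card_image_le ?_ _ ?_
  · rintro _ hf'
    obtain ⟨f, hf, rfl⟩ := Finset.mem_image.1 hf'
    refine (totalDegree_bind₁_le g (fun t => (totalDegree_lastCoeff_le _ _).trans (hLD _ _)) f).trans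
      (Nat.mul_le_mul_right _ (Finset.le_sup (f := totalDegree) hf))
  · rintro x x' hxx' ⟨z, hz, rfl⟩
    set x : Fin d → ℝ := fun i => z i.castSucc with hx
    obtain ⟨h, hh⟩ := hF (φ x) (φ x') fun f hf => hxx' _ (Finset.mem_image_of_mem _ hf)
    have hzx : Fin.snoc (α := fun _ => ℝ) x (z (Fin.last d)) = z := Fin.snoc_init_self z
    have key : ∀ b, ∀ P ∈ L b, SignType.sign (eval z P) =
        SignType.sign (eval (Fin.snoc (α := fun _ => ℝ) x' (h (z (Fin.last d)))) P) := by
      intro b P hP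
      obtain ⟨j, hj, rfl⟩ := List.getElem_of_mem hP
      have := hh (generalPoly D b j) (Finset.mem_image.2 ⟨(b, j), by
        simpa using hj.trans_le (hLl b), rfl⟩) (z (Fin.last d))
      rwa [hφ, hφ, hzx, List.getD_eq_getElem _ _ hj] at this
    refine ⟨Fin.snoc (α := fun _ => ℝ) x' (h (z (Fin.last d))), ⟨fun P hP => ?_, fun P hP => ?_⟩,
      by funext i; simp⟩
    · rw [← sign_eq_one_iff, ← key true P hP, sign_eq_one_iff]
      exact hz.1 P hP
    · rw [← sign_eq_zero_iff, ← key false P hP, sign_eq_zero_iff]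
      exact hz.2 P hP

theorem length_filter_le_sum {α : Type*} (f : α → ℕ) (l : List α) :
    (l.filter (f · ≠ 0)).length ≤ (l.map f).sum := by
  induction l with
  | nil => simp
  | cons a l ih =>
    rw [List.filter_cons, List.map_cons, List.sum_cons]
    split_ifs with h
    · have : f a ≠ 0 := by simpa using h
      rw [List.length_cons]
      omega
    · omega

/-- Constant polynomials may be dropped from a consistent system. -/
theorem conjSet_filter_totalDegree {d : ℕ}
    (c : List (MvPolynomial (Fin d) ℝ) × List (MvPolynomial (Fin d) ℝ))
    (hc : (conjSet c).Nonempty) :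
    conjSet (c.1.filter (totalDegree · ≠ 0), c.2.filter (totalDegree · ≠ 0)) = conjSet c := by
  obtain ⟨x₀, h1, h2⟩ := hc
  have hconst : ∀ x (P : MvPolynomial (Fin d) ℝ), P.totalDegree = 0 → eval x P = eval x₀ P := by
    intro x P hP
    rw [totalDegree_eq_zero_iff_eq_C] at hP
    rw [hP, eval_C, eval_C]
  ext x
  constructor
  · rintro ⟨g1, g2⟩
    refine ⟨fun P hP => ?_, fun P hP => ?_⟩
    · by_cases h0 : P.totalDegree = 0
      · rw [hconst x P h0]; exact h1 P hP
      · exact g1 P (by simp [hP, h0])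
    · by_cases h0 : P.totalDegree = 0
      · rw [hconst x P h0]; exact h2 P hP
      · exact g2 P (by simp [hP, h0])
  · rintro ⟨g1, g2⟩
    exact ⟨fun P hP => g1 P (List.mem_of_mem_filter hP),
      fun P hP => g2 P (List.mem_of_mem_filter hP)⟩

theorem exists_bound_projection (D : ℕ) :
    ∃ B : ℕ, ∀ (d : ℕ) (p : SAPres (d + 1)), p.deg ≤ D →
      ∃ q : SAPres d, q.toSet = (fun x (i : Fin d) => x i.castSucc) '' p.toSet ∧
        q.deg ≤ p.deg * B := by
  obtain ⟨B, hB⟩ := exists_bound_projection_conjSet D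
  refine ⟨B, fun d p => ?_⟩
  induction p with
  | nil => exact fun _ => ⟨[], by simp [SAPres.toSet], by simp [SAPres.deg]⟩
  | cons c p ih =>
    intro hD
    have hdeg : SAPres.deg (c :: p) =
        ((c.1.map totalDegree).sum + (c.2.map totalDegree).sum) + SAPres.deg p := by
      simp [SAPres.deg]
    have hset : SAPres.toSet (c :: p) = conjSet c ∪ SAPres.toSet p := by
      ext x
      simp [SAPres.toSet, conjSet]
    rw [hdeg] at hD ⊢
    obtain ⟨q, hq, hqB⟩ := ih (by omega)
    set m := (c.1.map totalDegree).sum + (c.2.map totalDegree).sum with hm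
    suffices ∃ r : SAPres d, r.toSet = (fun x (i : Fin d) => x i.castSucc) '' conjSet c ∧
        r.deg ≤ m * B by
      obtain ⟨r, hr, hrB⟩ := this
      refine ⟨r ++ q, ?_, ?_⟩
      · rw [SAPres.toSet_append, hset, image_union, hr, hq]
      · rw [SAPres.deg_append, add_mul]
        exact add_le_add hrB hqB
    rcases (conjSet c).eq_empty_or_nonempty with he | hne
    · exact ⟨[], by simp [he, SAPres.toSet], by simp [SAPres.deg]⟩
    rw [← conjSet_filter_totalDegree c hne]
    have hl1 := length_filter_le_sum totalDegree c.1
    have hl2 := length_filter_le_sum totalDegree c.2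
    by_cases h0 : m = 0
    · have e1 : c.1.filter (totalDegree · ≠ 0) = [] := List.length_eq_zero_iff.1 (by omega)
      have e2 : c.2.filter (totalDegree · ≠ 0) = [] := List.length_eq_zero_iff.1 (by omega)
      refine ⟨[([], [])], ?_, by simp [SAPres.deg]⟩
      rw [e1, e2]
      ext x
      simp only [SAPres.toSet, conjSet, List.mem_singleton, exists_eq_left, List.not_mem_nil,
        false_imp_iff, implies_true, and_self, ofPred_true, mem_univ, image_univ, true_iff]
      exact ⟨Fin.snoc (α := fun _ => ℝ) x 0, by funext i; simp⟩
    · have hle : ∀ (l : List (MvPolynomial (Fin (d + 1)) ℝ)), (l.map totalDegree).sum ≤ D →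
          ∀ P ∈ l.filter (totalDegree · ≠ 0), P.totalDegree ≤ D := fun l hl P hP =>
        (List.le_sum_of_mem (List.mem_map_of_mem (List.mem_of_mem_filter hP))).trans hl
      obtain ⟨r, hr, hrB⟩ := hB d (c.1.filter (totalDegree · ≠ 0), c.2.filter (totalDegree · ≠ 0))
        (hl1.trans (by omega)) (hl2.trans (by omega)) (hle _ (by omega)) (hle _ (by omega))
      exact ⟨r, hr, hrB.trans (Nat.le_mul_of_pos_left _ (Nat.pos_of_ne_zero h0))⟩

end Projection

/-- **Tarski's principle with degree bound.** The projection of a semi-algebraic set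
`A ⊆ ℝ^(d+1)` onto the first `d` coordinates is semi-algebraic, of degree bounded by a
function of `deg A` and `d` only. -/
theorem tarski_projection :
    ∃ C : ℕ → ℕ → ℕ, ∀ (d : ℕ) (A : Set (Fin (d + 1) → ℝ)), IsSemialgebraic A →
      IsSemialgebraic ((fun x (i : Fin d) => x i.castSucc) '' A) ∧
      SADeg ((fun x (i : Fin d) => x i.castSucc) '' A) ≤ C (SADeg A) d := by
  choose B hB using exists_bound_projection
  refine ⟨fun D _ => D * B D, fun d A hA => ?_⟩
  obtain ⟨p₀, hp₀⟩ := hA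
  obtain ⟨p, hp, hdeg⟩ : SADeg A ∈ SAPres.deg '' {p : SAPres (d + 1) | p.toSet = A} :=
    Nat.sInf_mem ⟨_, p₀, hp₀, rfl⟩
  obtain ⟨q, hq, hqB⟩ := hB (SADeg A) d p hdeg.le
  rw [mem_ofPred_eq] at hp
  rw [hp] at hq
  rw [hdeg] at hqB
  exact ⟨⟨q, hq⟩, (Nat.sInf_le (m := q.deg) (mem_image_of_mem SAPres.deg hq)).trans hqB⟩
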